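/- Let Λ = (Λ_j)_{j∈J} be a g-Riesz basis of (H,(H_j)) and Λ̃ = (Λ̃_j) its canonical dual, Λ̃_j = Λ_j ∘ S_Λ⁻¹. Then Λ and Λ̃ are biorthogonal: for all j ≠ k and all f ∈ H_j, g ∈ H_k one has ⟨Λ_j* f, Λ̃_k* g⟩_H = 0, and for all j and all f, g ∈ H_j one has ⟨Λ_j* f, Λ̃_j* g⟩_H = ⟨f, g⟩_{H_j}. -/

import Mathlib

open scoped ComplexInnerProductSpace

noncomputable section

variable {J H : Type*} [NormedAddCommGroup H] [InnerProductSpace ℂ H] [CompleteSpace H]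
  {G : J → Type*} [∀ j, NormedAddCommGroup (G j)] [∀ j, InnerProductSpace ℂ (G j)]
  [∀ j, CompleteSpace (G j)]

/-- `Λ` is an `(A,B)` g-frame of `(H, (G j))`. -/
def IsGFrameWith (Λ : ∀ j, H →L[ℂ] G j) (A B : ℝ) : Prop :=
  0 < A ∧ A ≤ B ∧ ∀ f : H,
    Summable (fun j => ‖Λ j f‖ ^ 2) ∧
    A * ‖f‖ ^ 2 ≤ ∑' j, ‖Λ j f‖ ^ 2 ∧
    ∑' j, ‖Λ j f‖ ^ 2 ≤ B * ‖f‖ ^ 2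

/-- `Λ` is a g-frame. -/
def IsGFrame (Λ : ∀ j, H →L[ℂ] G j) : Prop :=
  ∃ A B : ℝ, IsGFrameWith Λ A B

/-- `Λ` is a g-Bessel family with bound `B`. -/
def IsGBessel (Λ : ∀ j, H →L[ℂ] G j) (B : ℝ) : Prop :=
  0 < B ∧ ∀ f : H,
    Summable (fun j => ‖Λ j f‖ ^ 2) ∧ ∑' j, ‖Λ j f‖ ^ 2 ≤ B * ‖f‖ ^ 2

/-- The family `θ` is g-orthonormal. -/
def GOrthonormal (θ : ∀ j, H →L[ℂ] G j) : Prop :=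
  (∀ j k, j ≠ k → ∀ (f : G j) (g : G k),
    ⟪ContinuousLinearMap.adjoint (θ j) f, ContinuousLinearMap.adjoint (θ k) g⟫ = 0) ∧
  ∀ j, ∀ f g : G j,
    ⟪ContinuousLinearMap.adjoint (θ j) f, ContinuousLinearMap.adjoint (θ j) g⟫ = ⟪f, g⟫

/-- The family `θ` is a g-orthonormal basis. -/
def GONBasis (θ : ∀ j, H →L[ℂ] G j) : Prop :=
  GOrthonormal θ ∧ ∀ f : H, HasSum (fun j => ‖θ j f‖ ^ 2) (‖f‖ ^ 2)

/-- `Λ` is a g-Riesz basis: `Λ j = θ j ∘ X` for a g-orthonormal basis `θ` and a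
bounded operator `X` with bounded inverse. -/
def IsGRieszBasis (Λ : ∀ j, H →L[ℂ] G j) : Prop :=
  ∃ (X Xinv : H →L[ℂ] H) (θ : ∀ j, H →L[ℂ] G j),
    X.comp Xinv = ContinuousLinearMap.id ℂ H ∧
    Xinv.comp X = ContinuousLinearMap.id ℂ H ∧
    GONBasis θ ∧ ∀ j, Λ j = (θ j).comp X

/-- `S` is the g-frame operator of `Λ`: `S f = Σ_j Λ_j* (Λ_j f)`. -/
def IsGFrameOp (Λ : ∀ j, H →L[ℂ] G j) (S : H →L[ℂ] H) : Prop :=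
  ∀ f : H, HasSum (fun j => ContinuousLinearMap.adjoint (Λ j) (Λ j f)) (S f)

/-- `Γ` is a dual g-frame of `Λ`: it is a g-frame and `f = Σ_j Γ_j* (Λ_j f)`. -/
def IsDualGFrame (Λ Γ : ∀ j, H →L[ℂ] G j) : Prop :=
  IsGFrame Γ ∧ ∀ f : H, HasSum (fun j => ContinuousLinearMap.adjoint (Γ j) (Λ j f)) f


/-- For a g-orthonormal family, `θ_j* f` is mapped to `0` by every `θ_k` with `k ≠ j`. -/
theorem GOrthonormal.apply_adjoint_of_ne {θ : ∀ j, H →L[ℂ] G j} (hθ : GOrthonormal θ)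
    {j k : J} (hjk : j ≠ k) (f : G j) : θ k (ContinuousLinearMap.adjoint (θ j) f) = 0 :=
  ext_inner_right ℂ fun g => by
    rw [← ContinuousLinearMap.adjoint_inner_right, hθ.1 j k hjk, inner_zero_left]

/-- For a g-orthonormal family, `θ_j*` is a right inverse of `θ_j`. -/
theorem GOrthonormal.apply_adjoint_self {θ : ∀ j, H →L[ℂ] G j} (hθ : GOrthonormal θ)
    (j : J) (f : G j) : θ j (ContinuousLinearMap.adjoint (θ j) f) = f :=
  ext_inner_right ℂ fun g => by
    rw [← ContinuousLinearMap.adjoint_inner_right, hθ.2 j]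

/-- If `Λ_j = θ_j ∘ X` with `θ` g-orthonormal and `X` right invertible, then the g-frame operator
of `Λ` maps `X⁻¹ θ_j* f` to `Λ_j* f`. -/
theorem IsGFrameOp.apply_rightInv_adjoint {Λ θ : ∀ j, H →L[ℂ] G j} {S X Xinv : H →L[ℂ] H}
    (hS : IsGFrameOp Λ S) (hX : X.comp Xinv = ContinuousLinearMap.id ℂ H)
    (hθ : GOrthonormal θ) (hΛ : ∀ j, Λ j = (θ j).comp X) (j : J) (f : G j) :
    S (Xinv (ContinuousLinearMap.adjoint (θ j) f)) = ContinuousLinearMap.adjoint (Λ j) f := by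
  have key (k : J) : Λ k (Xinv (ContinuousLinearMap.adjoint (θ j) f)) =
      θ k (ContinuousLinearMap.adjoint (θ j) f) := by
    rw [hΛ k, ContinuousLinearMap.comp_apply]
    exact congrArg (θ k) (DFunLike.congr_fun hX _)
  have hsum := hasSum_single (f := fun k => ContinuousLinearMap.adjoint (Λ k)
    (Λ k (Xinv (ContinuousLinearMap.adjoint (θ j) f)))) j fun k hk => by
      rw [key, hθ.apply_adjoint_of_ne hk.symm, map_zero]
  rw [key, hθ.apply_adjoint_self] at hsum
  exact (hS _).unique hsum

/-- A g-Riesz basis and its canonical dual are biorthogonal. -/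
theorem stmt_1 (Λ : ∀ j, H →L[ℂ] G j) (hΛ : IsGRieszBasis Λ)
    (S Sinv : H →L[ℂ] H) (hS : IsGFrameOp Λ S)
    (hS1 : S.comp Sinv = ContinuousLinearMap.id ℂ H)
    (hS2 : Sinv.comp S = ContinuousLinearMap.id ℂ H) :
    (∀ j k, j ≠ k → ∀ (f : G j) (g : G k),
      ⟪ContinuousLinearMap.adjoint (Λ j) f,
        ContinuousLinearMap.adjoint ((Λ k).comp Sinv) g⟫ = 0) ∧
    ∀ j, ∀ f g : G j,
      ⟪ContinuousLinearMap.adjoint (Λ j) f,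
        ContinuousLinearMap.adjoint ((Λ j).comp Sinv) g⟫ = ⟪f, g⟫ := by
  obtain ⟨X, Xinv, θ, hX, -, ⟨hθ, -⟩, hΛ⟩ := hΛ
  have key (j k : J) (f : G j) (g : G k) :
      ⟪ContinuousLinearMap.adjoint (Λ j) f, ContinuousLinearMap.adjoint ((Λ k).comp Sinv) g⟫ =
        ⟪ContinuousLinearMap.adjoint (θ j) f, ContinuousLinearMap.adjoint (θ k) g⟫ := by
    have hSinv : Sinv (ContinuousLinearMap.adjoint (Λ j) f) =
        Xinv (ContinuousLinearMap.adjoint (θ j) f) := by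
      rw [← hS.apply_rightInv_adjoint hX hθ hΛ]
      exact DFunLike.congr_fun hS2 _
    have hXinv : X (Xinv (ContinuousLinearMap.adjoint (θ j) f)) =
        ContinuousLinearMap.adjoint (θ j) f := DFunLike.congr_fun hX _
    rw [ContinuousLinearMap.adjoint_inner_right, ContinuousLinearMap.comp_apply, hSinv, hΛ k,
      ContinuousLinearMap.comp_apply, hXinv, ContinuousLinearMap.adjoint_inner_right]
  exact ⟨fun j k hjk f g => (key j k f g).trans (hθ.1 j k hjk f g),
    fun j f g => (key j j f g).trans (hθ.2 j f g)⟩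

end
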